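/- arXiv:cs/0009001 — 2 statements merged into one kernel-verified Lean document; each statement's English description precedes it below -/
import Mathlib

section
/- Let U and V be partial functions from pairs (program, data) of finite binary strings to finite binary strings ("computers"), and for a computer C define K_C(α|d) as the minimum length of a program p with C(p,d) = α. Let B be an injective pairing map on pairs of binary strings with ⟨x,y⟩ = B(x,y). Fix a data string d, a string s, and a constant κ ∈ ℕ with K_U(s|d) finite. Suppose there is a bijection φ from the set {p : ∃ r, U(p,d) = ⟨r,s⟩} onto the set {q : V(q,d) is defined} such that whenever U(p,d) = ⟨r,s⟩ one has V(φ(p), d) = r and |φ(p)| = |p| − K_U(s|d) + κ. Then for every string r such that some program p satisfies U(p,d) = ⟨r,s⟩, one has K_V(r|d) = K_U(⟨r,s⟩|d) − K_U(s|d) + κ. -/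
/-- Conditional Kolmogorov complexity of `α` given data `d` relative to the
computer `C`: the minimum length of a program `p` with `C p d = α`. -/
noncomputable def Kc (C : List Bool → List Bool → Option (List Bool)) (α d : List Bool) : ℕ :=
  sInf {n : ℕ | ∃ p : List Bool, C p d = some α ∧ p.length = n}

theorem Kc_le_length {C : List Bool → List Bool → Option (List Bool)} {p α d : List Bool}
    (h : C p d = some α) : Kc C α d ≤ p.length :=
  Nat.sInf_le ⟨p, h, rfl⟩

theorem exists_length_eq_Kc {C : List Bool → List Bool → Option (List Bool)} {α d : List Bool}
    (h : ∃ p, C p d = some α) : ∃ p, C p d = some α ∧ p.length = Kc C α d :=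
  let ⟨p, hp⟩ := h
  Nat.sInf_mem (s := {n | ∃ p, C p d = some α ∧ p.length = n}) ⟨p.length, p, hp, rfl⟩

theorem stmt1
    (U V : List Bool → List Bool → Option (List Bool))
    (B : List Bool → List Bool → List Bool)
    (hB : Function.Injective2 B)
    (d s : List Bool) (κ : ℕ)
    -- K_U(s|d) is finite
    (hfin : ∃ p : List Bool, U p d = some s)
    -- the bijection φ
    (φ : List Bool → List Bool)
    (hbij : Set.BijOn φ {p : List Bool | ∃ r : List Bool, U p d = some (B r s)}
                        {q : List Bool | (V q d).isSome})
    (hφ : ∀ p r : List Bool, U p d = some (B r s) →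
      V (φ p) d = some r ∧
      ((φ p).length : ℤ) = (p.length : ℤ) - (Kc U s d : ℤ) + (κ : ℤ)) :
    ∀ r : List Bool, (∃ p : List Bool, U p d = some (B r s)) →
      (Kc V r d : ℤ) = (Kc U (B r s) d : ℤ) - (Kc U s d : ℤ) + (κ : ℤ) := by
  intro r hr
  obtain ⟨p, hp, hp_len⟩ := exists_length_eq_Kc hr
  obtain ⟨hVp, hφp_len⟩ := hφ p r hp
  obtain ⟨q, hq, hq_len⟩ := exists_length_eq_Kc ⟨φ p, hVp⟩
  obtain ⟨p', ⟨r', hp'⟩, rfl⟩ := hbij.surjOn (show (V q d).isSome by simp [hq])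
  obtain ⟨hVp', hφp'_len⟩ := hφ p' r' hp'
  obtain rfl : r' = r := Option.some.inj (hVp'.symm.trans hq)
  have hV_le := Kc_le_length hVp
  have hU_le := Kc_le_length hp'
  omega
end

section
/- Let r : ℕ → (finite binary strings) and, for each data string d, let l : ℕ → (d ↦ l_k(d)) be requested program lengths such that for every data string d the sum over k of 2^{−l_k(d)} is at most 1. Then there exists a partial function C from pairs (program, data) of finite binary strings to finite binary strings such that for every data string d: (i) the set of programs p for which C(p,d) is defined is prefix-free; and (ii) there is a bijection k ↦ p_k(d) from ℕ onto this set of programs satisfying C(p_k(d), d) = r_k and |p_k(d)| = l_k(d) for every k. That is, for each result r, length l, and data d, there are precisely as many programs p of length l with C(p,d) = r as there are indices k with r_k = r and l_k(d) = l. -/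
open scoped ENNReal

/-- The `n` low-order binary digits of `a`, most significant digit first. -/
def binaryWord : ℕ → ℕ → List Bool
  | 0, _ => []
  | n + 1, a => binaryWord n (a / 2) ++ [a.bodd]

theorem length_binaryWord (n a : ℕ) : (binaryWord n a).length = n := by
  induction n generalizing a with
  | zero => rfl
  | succ n ih => simp [binaryWord, ih]

theorem binaryWord_injOn {n a b : ℕ} (ha : a < 2 ^ n) (hb : b < 2 ^ n)
    (h : binaryWord n a = binaryWord n b) : a = b := by
  induction n generalizing a b with
  | zero => simp at ha hb; omega
  | succ n ih =>
    obtain ⟨h₁, h₂⟩ := List.append_inj' h rfl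
    have hdiv := ih (by omega) (by omega) h₁
    have hmod : a % 2 = b % 2 := by
      rw [Nat.mod_two_of_bodd, Nat.mod_two_of_bodd, (List.cons.inj h₂).1]
    omega

theorem binaryWord_div_prefix (n m a : ℕ) :
    binaryWord n (a / 2 ^ m) <+: binaryWord (n + m) a := by
  induction m generalizing a with
  | zero => simp
  | succ m ih =>
    have h := ih (a / 2)
    rw [Nat.div_div_eq_div_mul, ← pow_succ'] at h
    exact h.trans (List.prefix_append _ _)

theorem eq_div_of_binaryWord_prefix {n m a b : ℕ} (hnm : n ≤ m) (ha : a < 2 ^ n) (hb : b < 2 ^ m)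
    (h : binaryWord n a <+: binaryWord m b) : a = b / 2 ^ (m - n) := by
  obtain ⟨k, rfl⟩ := Nat.exists_eq_add_of_le hnm
  rw [Nat.add_sub_cancel_left]
  refine binaryWord_injOn ha (Nat.div_lt_of_lt_mul (by rwa [← pow_add, add_comm])) ?_
  have hp := List.prefix_of_prefix_length_le h (binaryWord_div_prefix n k b)
    (by simp [length_binaryWord])
  exact hp.eq_of_length (by simp [length_binaryWord])

theorem sum_two_pow_sub_le {l : ℕ → ℕ} (hl : ∑' k : ℕ, ((2 : ℝ≥0∞) ^ (-(l k : ℤ))) ≤ 1)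
    (s : Finset ℕ) (L : ℕ) (hs : ∀ j ∈ s, l j ≤ L) : ∑ j ∈ s, 2 ^ (L - l j) ≤ 2 ^ L := by
  have h : ((∑ j ∈ s, 2 ^ (L - l j) : ℕ) : ℝ≥0∞) ≤ ((2 ^ L : ℕ) : ℝ≥0∞) := by
    calc ((∑ j ∈ s, 2 ^ (L - l j) : ℕ) : ℝ≥0∞)
        = 2 ^ L * ∑ j ∈ s, (2 : ℝ≥0∞) ^ (-(l j : ℤ)) := by
          rw [Finset.mul_sum]
          push_cast
          refine Finset.sum_congr rfl fun j hj => ?_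
          rw [← zpow_natCast, ← zpow_natCast, ← ENNReal.zpow_add (by simp) (by simp),
            Nat.cast_sub (hs j hj), sub_eq_add_neg]
      _ ≤ 2 ^ L * 1 := by gcongr; exact (ENNReal.sum_le_tsum s).trans hl
      _ = ((2 ^ L : ℕ) : ℝ≥0∞) := by simp
  exact_mod_cast h

theorem finite_setOf_le_of_kraft {l : ℕ → ℕ}
    (hl : ∑' k : ℕ, ((2 : ℝ≥0∞) ^ (-(l k : ℤ))) ≤ 1) (L : ℕ) : {j | l j ≤ L}.Finite := by
  have h := ENNReal.finite_const_le_of_tsum_ne_top (ne_top_of_le_ne_top ENNReal.one_ne_top hl)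
    (ε := (2 : ℝ≥0∞) ^ (-(L : ℤ))) (ENNReal.zpow_pos (by simp) (by simp) _).ne'
  refine h.subset fun j hj => ?_
  have hj' : l j ≤ L := hj
  exact ENNReal.zpow_le_of_le (by norm_num) (by omega)

/-- Lengths satisfying the Kraft inequality are the lengths of the words of a prefix-free code. -/
theorem exists_prefixFree_of_kraft {l : ℕ → ℕ}
    (hl : ∑' k : ℕ, ((2 : ℝ≥0∞) ^ (-(l k : ℤ))) ≤ 1) :
    ∃ w : ℕ → List Bool, (∀ k, (w k).length = l k) ∧ ∀ j k, w j <+: w k → j = k := by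
  classical
  let before (k : ℕ) : Finset ℕ := (finite_setOf_le_of_kraft hl (l k)).toFinset.filter
    fun j => l j < l k ∨ l j = l k ∧ j < k
  have mem_before (j k : ℕ) : j ∈ before k ↔ l j < l k ∨ l j = l k ∧ j < k := by
    simp only [before, Finset.mem_filter, Set.Finite.mem_toFinset, Set.mem_ofPred_eq]
    omega
  let N (k : ℕ) : ℕ := ∑ j ∈ before k, 2 ^ (l k - l j)
  have sum_insert (k L : ℕ) (hk : l k ≤ L) :
      ∑ j ∈ insert k (before k), 2 ^ (L - l j) = (N k + 1) * 2 ^ (L - l k) := by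
    rw [Finset.sum_insert (by simp [mem_before]), add_mul, one_mul, add_comm, Finset.sum_mul]
    congr 1
    refine Finset.sum_congr rfl fun j hj => ?_
    rw [mem_before] at hj
    rw [← pow_add]
    congr 1
    omega
  have N_lt (k : ℕ) : N k < 2 ^ l k := by
    have h := sum_two_pow_sub_le hl (insert k (before k)) (l k) (by
      intro j hj
      rw [Finset.mem_insert, mem_before] at hj
      rcases hj with rfl | hj <;> omega)
    rw [sum_insert k _ le_rfl] at h
    simpa using h
  have step (j k : ℕ) (hjk : j ∈ before k) : (N j + 1) * 2 ^ (l k - l j) ≤ N k := by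
    rw [mem_before] at hjk
    rw [← sum_insert j (l k) (by omega)]
    refine Finset.sum_le_sum_of_subset fun i hi => ?_
    rw [Finset.mem_insert, mem_before] at hi
    rw [mem_before]
    rcases hi with rfl | hi <;> omega
  have not_prefix (j k : ℕ) (hjk : j ∈ before k) :
      ¬ binaryWord (l j) (N j) <+: binaryWord (l k) (N k) := by
    intro h
    have hle : l j ≤ l k := by rw [mem_before] at hjk; omega
    have h₁ := eq_div_of_binaryWord_prefix hle (N_lt j) (N_lt k) h
    have h₂ := (Nat.le_div_iff_mul_le (by positivity)).2 (step j k hjk)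
    omega
  refine ⟨fun k => binaryWord (l k) (N k), fun k => length_binaryWord _ _, fun j k h => ?_⟩
  by_contra hne
  have hle : l j ≤ l k := by simpa [length_binaryWord] using h.length_le
  by_cases hjk : j ∈ before k
  · exact not_prefix j k hjk h
  · rw [mem_before] at hjk
    have heq := h.eq_of_length (by simp only [length_binaryWord]; omega)
    exact not_prefix k j (by rw [mem_before]; omega) ⟨[], by simpa using heq.symm⟩

theorem stmt7 (r : ℕ → List Bool) (l : List Bool → ℕ → ℕ)
    (hkraft : ∀ d : List Bool, ∑' k : ℕ, ((2 : ℝ≥0∞) ^ (-(l d k : ℤ))) ≤ 1) :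
    ∃ C : List Bool → List Bool → Option (List Bool),
      ∀ d : List Bool,
        -- (i) the program domain is prefix-free
        (∀ p q : List Bool, (C p d).isSome → (C q d).isSome → p ≠ q → ¬ p <+: q) ∧
        -- (ii) programs correspond one-to-one to the requirements
        ∃ pk : ℕ → List Bool, Function.Injective pk ∧
          (∀ k : ℕ, C (pk k) d = some (r k) ∧ (pk k).length = l d k) ∧
          (∀ q : List Bool, (C q d).isSome → ∃ k : ℕ, q = pk k) := by
  classical
  choose w hlen hpre using fun d => exists_prefixFree_of_kraft (hkraft d)
  have hinj (d : List Bool) : Function.Injective (w d) :=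
    fun j k h => hpre d j k (h ▸ List.prefix_rfl)
  let C (p d : List Bool) : Option (List Bool) :=
    if h : ∃ k, p = w d k then some (r h.choose) else none
  have hdom (p d : List Bool) (h : (C p d).isSome) : ∃ k, p = w d k := by
    by_contra hn
    simp [C, hn] at h
  refine ⟨C, fun d => ⟨fun p q hp hq hne hpq => ?_, w d, hinj d, fun k => ⟨?_, hlen d k⟩,
    fun q => hdom q d⟩⟩
  · obtain ⟨j, rfl⟩ := hdom p d hp
    obtain ⟨k, rfl⟩ := hdom q d hq
    exact hne (congrArg (w d) (hpre d j k hpq))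
  · have h : ∃ i, w d k = w d i := ⟨k, rfl⟩
    simp only [C, dif_pos h]
    rw [← hinj d h.choose_spec]
end
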